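/- Let μ = ⊗_{k≥1} Exp(k) on ℝ^ℕ, where the k-th factor has rate k, and let r > 0. Then for every x ∈ ℝ^ℕ with x_k → 0 one has the strict inequality μ(B_r(x)) < ∏_{k≥1} (1 − e^{−2 k r}) = sup{ μ(B_r(z)) : z ∈ ℝ^ℕ, z_k → 0 }. In particular, the function x ↦ μ(B_r(x)) has no maximizer on the space of null sequences. -/

import Mathlib

open MeasureTheory Filter ProbabilityTheory Real

lemma aux_prod (s : ℝ) (hs : 0 < s) : ∃ L : ℝ, 0 < L ∧
    Tendsto (fun n => ∏ k ∈ Finset.range n, (1 - exp (-(((k : ℝ) + 1) * s)))) atTop (nhds L) := by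
  have hsum : Summable (fun k : ℕ => -exp (-(((k : ℝ) + 1) * s))) := by
    have h1 : Summable (fun k : ℕ => (exp (-s)) ^ (k + 1)) :=
      (summable_nat_add_iff 1).2 (summable_geometric_of_lt_one (exp_pos _).le (by simpa using hs))
    refine h1.neg.congr fun k => ?_
    rw [← Real.exp_nat_mul]
    push_cast
    congr 2
    ring
  have hpos : ∀ k : ℕ, 0 < 1 + -exp (-(((k : ℝ) + 1) * s)) := by
    intro k
    have : exp (-(((k : ℝ) + 1) * s)) < 1 := by
      rw [Real.exp_lt_one_iff]
      have : 0 < ((k : ℝ) + 1) * s := by positivity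
      linarith
    linarith
  have hm := multipliable_one_add_of_summable hsum.norm
  have ht := hm.hasProd.tendsto_prod_nat
  have hne := tprod_one_add_ne_zero_of_summable (fun k => (hpos k).ne') hsum.norm
  refine ⟨_, lt_of_le_of_ne ?_ (Ne.symm hne), ?_⟩
  · exact ge_of_tendsto' ht fun n => Finset.prod_nonneg fun k _ => (hpos k).le
  · simpa [sub_eq_add_neg] using ht

lemma aux_Icc (l : ℝ) (hl : 0 < l) (a b : ℝ) (hab : a ≤ b) :
    (expMeasure l).real (Set.Icc a b) = (if 0 ≤ b then 1 - exp (-(l * b)) else 0) -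
      (if 0 ≤ a then 1 - exp (-(l * a)) else 0) := by
  have := isProbabilityMeasure_expMeasure hl
  have hna : NullSingletonClass (expMeasure l) := by
    unfold expMeasure gammaMeasure
    infer_instance
  have h1 : (expMeasure l).real (Set.Icc a b) = (expMeasure l).real (Set.Ioc a b) :=
    measureReal_congr Ioc_ae_eq_Icc.symm
  have hd : Set.Ioc a b = Set.Iic b \ Set.Iic a := by
    ext x
    simp [and_comm]
  rw [h1, hd, measureReal_diff (Set.Iic_subset_Iic.2 hab) measurableSet_Iic,
    ← cdf_eq_real, ← cdf_eq_real, cdf_expMeasure_eq hl, cdf_expMeasure_eq hl]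

lemma aux_r (l r : ℝ) (hl : 0 < l) (hr : 0 < r) :
    (expMeasure l).real (Set.Icc (r - r) (r + r)) = 1 - exp (-(l * (2 * r))) := by
  rw [aux_Icc l hl _ _ (by linarith), if_pos (by linarith), if_pos (by linarith)]
  simp [two_mul]

lemma aux_0 (l r : ℝ) (hl : 0 < l) (hr : 0 < r) :
    (expMeasure l).real (Set.Icc (0 - r) (0 + r)) = 1 - exp (-(l * r)) := by
  rw [aux_Icc l hl _ _ (by linarith), if_pos (by linarith), if_neg (by linarith)]
  simp

lemma aux_lt (l r t : ℝ) (hl : 0 < l) (hr : 0 < r) (ht : t ≠ r) :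
    (expMeasure l).real (Set.Icc (t - r) (t + r)) < 1 - exp (-(l * (2 * r))) := by
  have h1 : exp (-(l * (2 * r))) < 1 := by
    rw [Real.exp_lt_one_iff]
    have : 0 < l * (2 * r) := by positivity
    linarith
  rw [aux_Icc l hl _ _ (by linarith)]
  rcases lt_or_gt_of_ne ht with h | h
  · rw [if_neg (by linarith : ¬ 0 ≤ t - r)]
    split_ifs
    · have : exp (-(l * (2 * r))) < exp (-(l * (t + r))) := by
        rw [Real.exp_lt_exp]
        nlinarith
      linarith
    · linarith
  · rw [if_pos (by linarith), if_pos (by linarith)]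
    have h2 : exp (-(l * (t + r))) = exp (-(l * (t - r))) * exp (-(l * (2 * r))) := by
      rw [← Real.exp_add]; congr 1; ring
    have h3 : exp (-(l * (t - r))) < 1 := by
      rw [Real.exp_lt_one_iff]
      nlinarith
    rw [h2]
    nlinarith

lemma aux_le (l r t : ℝ) (hl : 0 < l) (hr : 0 < r) :
    (expMeasure l).real (Set.Icc (t - r) (t + r)) ≤ 1 - exp (-(l * (2 * r))) := by
  by_cases h : t = r
  · subst h; exact (aux_r l _ hl hr).le
  · exact (aux_lt l r t hl hr h).le

lemma aux_tendsto (μ : Measure (ℕ → ℝ)) [IsProbabilityMeasure μ]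
    (hμ : ∀ n : ℕ, Measure.map (fun x (i : Fin n) => x i) μ
      = Measure.pi (fun i : Fin n => expMeasure ((i : ℕ) + 1)))
    (r : ℝ) (x : ℕ → ℝ) :
    Tendsto (fun n => ∏ k ∈ Finset.range n,
      (expMeasure ((k : ℝ) + 1)).real (Set.Icc (x k - r) (x k + r))) atTop
      (nhds (μ.real {y : ℕ → ℝ | ∀ k, |y k - x k| ≤ r})) := by
  let S : ℕ → Set (ℕ → ℝ) := fun n =>
    (fun (y : ℕ → ℝ) (i : Fin n) => y i) ⁻¹'
      (Set.univ.pi fun i : Fin n => Set.Icc (x i - r) (x i + r))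
  have hmeas : ∀ n : ℕ, Measurable (fun (y : ℕ → ℝ) (i : Fin n) => y i) := fun n => by fun_prop
  have hpi : ∀ n : ℕ, MeasurableSet
      (Set.univ.pi fun i : Fin n => Set.Icc (x i - r) (x i + r)) := fun n =>
    MeasurableSet.univ_pi fun i => measurableSet_Icc
  have hmem : ∀ n y, y ∈ S n ↔ ∀ i : Fin n, y i ∈ Set.Icc (x i - r) (x i + r) := by
    intro n y; simp only [S, Set.mem_preimage, Set.mem_univ_pi]
  have hB : {y : ℕ → ℝ | ∀ k, |y k - x k| ≤ r} = ⋂ n, S n := by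
    ext y
    simp only [Set.mem_ofPred_eq, Set.mem_iInter, hmem]
    constructor
    · intro h n i
      have := abs_le.1 (h i)
      exact ⟨by linarith, by linarith⟩
    · intro h k
      have := h (k + 1) ⟨k, Nat.lt_succ_self k⟩
      simp only [Set.mem_Icc] at this
      exact abs_le.2 ⟨by linarith, by linarith⟩
  have hanti : Antitone S := by
    intro m n hmn y hy
    rw [hmem] at hy ⊢
    intro i
    exact hy ⟨i, i.2.trans_le hmn⟩
  have hlim := tendsto_measure_iInter_atTop (μ := μ) (s := S)
    (fun n => ((hmeas n) (hpi n)).nullMeasurableSet) hanti ⟨0, measure_ne_top _ _⟩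
  rw [← hB] at hlim
  have hlim2 := (ENNReal.tendsto_toReal (measure_ne_top μ _)).comp hlim
  refine hlim2.congr fun n => ?_
  have : ∀ i : Fin n, IsProbabilityMeasure (expMeasure ((i : ℕ) + 1 : ℝ)) := fun i =>
    isProbabilityMeasure_expMeasure (by positivity)
  simp only [Function.comp]
  change (μ (S n)).toReal = _
  rw [← Measure.map_apply (hmeas n) (hpi n), hμ n, Measure.pi_pi, ENNReal.toReal_prod,
    ← Fin.prod_univ_eq_prod_range (fun k : ℕ =>
      (expMeasure ((k : ℝ) + 1)).real (Set.Icc (x k - r) (x k + r))) n]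
  rfl

theorem exp_product_ball_no_maximizer
    (μ : Measure (ℕ → ℝ)) [IsProbabilityMeasure μ]
    (hμ : ∀ n : ℕ, Measure.map (fun x (i : Fin n) => x i) μ
      = Measure.pi (fun i : Fin n => expMeasure ((i : ℕ) + 1)))
    (r : ℝ) (hr : 0 < r) :
    Tendsto (fun n => ∏ k ∈ Finset.range n, (1 - exp (-(2 * ((k : ℝ) + 1) * r))))
      atTop (nhds ((⨆ x : {x : ℕ → ℝ // Tendsto x atTop (nhds 0)},
        μ {y : ℕ → ℝ | ∀ k, |y k - x.1 k| ≤ r}).toReal)) ∧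
    ∀ x : ℕ → ℝ, Tendsto x atTop (nhds 0) →
      μ {y : ℕ → ℝ | ∀ k, |y k - x k| ≤ r} <
        ⨆ z : {z : ℕ → ℝ // Tendsto z atTop (nhds 0)},
          μ {y : ℕ → ℝ | ∀ k, |y k - z.1 k| ≤ r} := by
  obtain ⟨P, hP, hPt⟩ := aux_prod (2 * r) (by positivity)
  obtain ⟨C, hC, hCt⟩ := aux_prod r hr
  have hl : ∀ k : ℕ, (0 : ℝ) < (k : ℝ) + 1 := fun k => by positivity
  have apos : ∀ s : ℝ, 0 < s → ∀ k : ℕ, 0 < 1 - exp (-(((k : ℝ) + 1) * s)) := by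
    intro s hs k
    have : exp (-(((k : ℝ) + 1) * s)) < 1 := by
      rw [Real.exp_lt_one_iff]
      have : 0 < ((k : ℝ) + 1) * s := by positivity
      linarith
    linarith
  have hlt : ∀ x : ℕ → ℝ, Tendsto x atTop (nhds 0) →
      μ.real {y : ℕ → ℝ | ∀ k, |y k - x k| ≤ r} < P := by
    intro x hx
    obtain ⟨K, hK⟩ : ∃ K, x K ≠ r := by
      by_contra! h
      have : x = fun _ => r := funext h
      rw [this] at hx
      exact hr.ne' (tendsto_nhds_unique tendsto_const_nhds hx)
    have h1 := aux_tendsto μ hμ r x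
    set q : ℕ → ℝ := fun k => (expMeasure ((k : ℝ) + 1)).real (Set.Icc (x k - r) (x k + r))
    set a : ℕ → ℝ := fun k => 1 - exp (-(((k : ℝ) + 1) * (2 * r)))
    have hq : ∀ k, q k ≤ a k := fun k => aux_le _ r (x k) (hl k) hr
    have hq0 : ∀ k, 0 ≤ q k := fun k => measureReal_nonneg
    have hqK : q K < a K := aux_lt _ r (x K) (hl K) hr hK
    have haK : 0 < a K := apos _ (by positivity) K
    have h2 : μ.real {y : ℕ → ℝ | ∀ k, |y k - x k| ≤ r} * a K ≤ q K * P := by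
      refine le_of_tendsto_of_tendsto (h1.mul_const (a K)) (hPt.const_mul (q K)) ?_
      filter_upwards [eventually_gt_atTop K] with n hn
      have hmem : K ∈ Finset.range n := Finset.mem_range.2 hn
      change (∏ k ∈ Finset.range n, q k) * a K ≤ q K * ∏ k ∈ Finset.range n, a k
      rw [← Finset.mul_prod_erase _ q hmem, ← Finset.mul_prod_erase _ a hmem]
      have h3 : ∏ k ∈ (Finset.range n).erase K, q k ≤ ∏ k ∈ (Finset.range n).erase K, a k :=
        Finset.prod_le_prod (fun k _ => hq0 k) (fun k _ => hq k)
      have h4 := mul_le_mul_of_nonneg_left h3 (mul_nonneg (hq0 K) haK.le)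
      linarith
    have h5 : q K * P < a K * P := mul_lt_mul_of_pos_right hqK hP
    nlinarith
  have hsup : (⨆ z : {z : ℕ → ℝ // Tendsto z atTop (nhds 0)},
          μ {y : ℕ → ℝ | ∀ k, |y k - z.1 k| ≤ r}) = ENNReal.ofReal P := by
    apply le_antisymm
    · refine iSup_le fun z => ?_
      rw [← ENNReal.ofReal_toReal (measure_ne_top μ _)]
      exact ENNReal.ofReal_le_ofReal (hlt z.1 z.2).le
    · let z : ℕ → ℕ → ℝ := fun N k => if k < N then r else 0
      have hz : ∀ N, Tendsto (z N) atTop (nhds 0) := by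
        intro N
        refine tendsto_const_nhds.congr' ?_
        filter_upwards [eventually_ge_atTop N] with k hk
        simp [z, not_lt.2 hk]
      set A : ℕ → ℝ := fun n => ∏ k ∈ Finset.range n, (1 - exp (-(((k : ℝ) + 1) * (2 * r))))
      set D : ℕ → ℝ := fun n => ∏ k ∈ Finset.range n, (1 - exp (-(((k : ℝ) + 1) * r)))
      have hD : ∀ n, 0 < D n := fun n => Finset.prod_pos fun k _ => apos r hr k
      have hval : ∀ N, μ.real {y : ℕ → ℝ | ∀ k, |y k - z N k| ≤ r} = A N * C / D N := by
        intro N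
        rw [eq_div_iff (hD N).ne']
        refine tendsto_nhds_unique ((aux_tendsto μ hμ r (z N)).mul_const (D N))
          ((hCt.const_mul (A N)).congr' ?_)
        filter_upwards [eventually_ge_atTop N] with n hn
        change A N * D n = _ * D N
        induction n, hn using Nat.le_induction with
        | base =>
          congr 1
          refine Finset.prod_congr rfl fun k hk => ?_
          have hz1 : z N k = r := if_pos (Finset.mem_range.1 hk)
          rw [hz1, aux_r _ _ (hl k) hr]
        | succ n hn ih =>
          have hz1 : z N n = 0 := if_neg (not_lt.2 hn)
          have hD1 : D (n + 1) = D n * (1 - exp (-(((n : ℝ) + 1) * r))) :=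
            Finset.prod_range_succ _ _
          rw [Finset.prod_range_succ, hz1, aux_0 _ _ (hl n) hr, hD1, ← mul_assoc, ih]
          ring
      have hlim : Tendsto (fun N => ENNReal.ofReal (A N * C / D N)) atTop
          (nhds (ENNReal.ofReal P)) := by
        apply ENNReal.tendsto_ofReal
        have := (hPt.mul_const C).div hCt hC.ne'
        rwa [mul_div_cancel_right₀ _ hC.ne'] at this
      refine le_of_tendsto' hlim fun N => ?_
      rw [← hval N, ofReal_measureReal]
      exact le_iSup (fun z : {z : ℕ → ℝ // Tendsto z atTop (nhds 0)} =>
          μ {y : ℕ → ℝ | ∀ k, |y k - z.1 k| ≤ r}) ⟨z N, hz N⟩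
  rw [hsup]
  constructor
  · rw [ENNReal.toReal_ofReal hP.le]
    refine hPt.congr fun n => Finset.prod_congr rfl fun k _ => ?_
    congr 3
    ring
  · intro x hx
    rw [ENNReal.lt_ofReal_iff_toReal_lt (measure_ne_top μ _)]
    exact hlt x hx
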